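/- Suppose A ∈ ℝ^{n×n} is symmetric with nonnegative entries, has minimum node degree at least α ≥ 0, and satisfies ‖A‖₂ ≤ β_A; suppose ‖X‖_F ≤ β_X, ‖W^{(k)}‖₂ ≤ β_W for all k, and σ is ρ-Lipschitz with σ(0) = 0. Then every hidden embedding of the GCN satisfies ‖X^{(l)}‖_F ≤ ρ^l β_W^l β_X (1 + β_A)^l (1 + α)^{−l} for all l = 1, …, L. -/

import Mathlib

open Matrix BigOperators Finset

noncomputable def specNorm {m n : Type*} [Fintype m] [Fintype n] [DecidableEq n]
    (A : Matrix m n ℝ) : ℝ :=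
  ‖LinearMap.toContinuousLinearMap (Matrix.toEuclideanLin A)‖

noncomputable def frobNorm {m n : Type*} [Fintype m] [Fintype n] (A : Matrix m n ℝ) : ℝ :=
  Real.sqrt (∑ i, ∑ j, (A i j) ^ 2)

noncomputable def vecNorm {ι : Type*} [Fintype ι] (v : ι → ℝ) : ℝ :=
  Real.sqrt (∑ i, (v i) ^ 2)

noncomputable def normAdj {v : Type*} [Fintype v] [DecidableEq v]
    (A : Matrix v v ℝ) : Matrix v v ℝ :=
  Matrix.diagonal (fun i => (Real.sqrt (∑ j, (1 + A) i j))⁻¹) * (1 + A) *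
    Matrix.diagonal (fun i => (Real.sqrt (∑ j, (1 + A) i j))⁻¹)

noncomputable def deltaD {v : Type*} [Fintype v] [DecidableEq v]
    (A ΔA : Matrix v v ℝ) : Matrix v v ℝ :=
  1 - Matrix.diagonal (fun i => Real.sqrt (∑ j, (1 + (A + ΔA)) i j)) *
      Matrix.diagonal (fun i => (Real.sqrt (∑ j, (1 + A) i j))⁻¹)

noncomputable def gcn {v : Type*} [Fintype v] (U : Matrix v v ℝ) (σ : ℝ → ℝ)
    {d : ℕ → ℕ} (W : (l : ℕ) → Matrix (Fin (d l)) (Fin (d (l + 1))) ℝ)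
    (X0 : Matrix v (Fin (d 0)) ℝ) : (l : ℕ) → Matrix v (Fin (d l)) ℝ
  | 0 => X0
  | l + 1 => (U * gcn U σ W X0 l * W l).map σ

noncomputable def avgPool {v p : Type*} [Fintype v] [Fintype p]
    (X : Matrix v p ℝ) : p → ℝ :=
  fun j => (∑ i, X i j) / (Fintype.card v : ℝ)

noncomputable def ensembleRep {n M : ℕ} {d : ℕ → ℕ} (A : Matrix (Fin n) (Fin n) ℝ)
    (σ : ℝ → ℝ) (W : Fin M → (l : ℕ) → Matrix (Fin (d l)) (Fin (d (l + 1))) ℝ)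
    (X : Matrix (Fin n) (Fin (d 0)) ℝ) (lam : Fin M → ℝ) (L : ℕ) : Fin (d L) → ℝ :=
  fun j => ∑ m, lam m * avgPool (gcn (normAdj A) σ (W m) X L) j

def principalSub {n : ℕ} (A : Matrix (Fin n) (Fin n) ℝ) (s : Finset (Fin n)) :
    Matrix s s ℝ :=
  A.submatrix (fun i => (i : Fin n)) (fun j => (j : Fin n))

def rowSub {n p : ℕ} (X : Matrix (Fin n) (Fin p) ℝ) (s : Finset (Fin n)) :
    Matrix s (Fin p) ℝ :=
  X.submatrix (fun i => (i : Fin n)) id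

section L2Operator

open scoped Matrix.Norms.L2Operator

variable {l m n : Type*} [Fintype l] [Fintype m] [Fintype n]

theorem specNorm_eq_norm [DecidableEq n] (A : Matrix m n ℝ) : specNorm A = ‖A‖ := rfl

theorem specNorm_nonneg [DecidableEq n] (A : Matrix m n ℝ) : 0 ≤ specNorm A :=
  norm_nonneg _

theorem specNorm_transpose [DecidableEq m] [DecidableEq n] (A : Matrix m n ℝ) :
    specNorm Aᵀ = specNorm A := by
  rw [specNorm_eq_norm, specNorm_eq_norm, ← Matrix.l2_opNorm_conjTranspose A,
    Matrix.conjTranspose_eq_transpose_of_trivial]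

theorem sum_mulVec_sq_le [DecidableEq n] (A : Matrix m n ℝ) (v : n → ℝ) :
    ∑ i, ((A *ᵥ v) i) ^ 2 ≤ specNorm A ^ 2 * ∑ j, v j ^ 2 := by
  have h := pow_le_pow_left₀ (norm_nonneg _) (Matrix.l2_opNorm_mulVec A (WithLp.toLp 2 v)) 2
  rw [mul_pow, EuclideanSpace.real_norm_sq_eq, EuclideanSpace.real_norm_sq_eq] at h
  exact h

theorem frobNorm_nonneg (A : Matrix m n ℝ) : 0 ≤ frobNorm A := Real.sqrt_nonneg _

theorem frobNorm_transpose (A : Matrix m n ℝ) : frobNorm Aᵀ = frobNorm A := by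
  simp only [frobNorm, Matrix.transpose_apply]
  rw [Finset.sum_comm]

theorem frobNorm_mul_le_specNorm_mul [DecidableEq m] (A : Matrix l m ℝ) (B : Matrix m n ℝ) :
    frobNorm (A * B) ≤ specNorm A * frobNorm B := by
  unfold frobNorm
  refine Real.sqrt_le_iff.mpr ⟨mul_nonneg (specNorm_nonneg A) (Real.sqrt_nonneg _), ?_⟩
  rw [mul_pow, Real.sq_sqrt (by positivity), Finset.sum_comm, Finset.sum_comm (s := univ (α := m)),
    Finset.mul_sum]
  exact Finset.sum_le_sum fun j _ => sum_mulVec_sq_le A fun i => B i j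

theorem frobNorm_mul_le_mul_specNorm [DecidableEq m] [DecidableEq n]
    (A : Matrix l m ℝ) (B : Matrix m n ℝ) :
    frobNorm (A * B) ≤ frobNorm A * specNorm B := by
  rw [← frobNorm_transpose, Matrix.transpose_mul, mul_comm (frobNorm A), ← frobNorm_transpose A,
    ← specNorm_transpose B]
  exact frobNorm_mul_le_specNorm_mul _ _

theorem frobNorm_map_le (A : Matrix m n ℝ) {σ : ℝ → ℝ} {ρ : ℝ} (hρ : 0 ≤ ρ)
    (hσ : ∀ a, |σ a| ≤ ρ * |a|) : frobNorm (A.map σ) ≤ ρ * frobNorm A := by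
  unfold frobNorm
  refine Real.sqrt_le_iff.mpr ⟨mul_nonneg hρ (Real.sqrt_nonneg _), ?_⟩
  rw [mul_pow, Real.sq_sqrt (by positivity), Finset.mul_sum]
  refine Finset.sum_le_sum fun i _ => ?_
  rw [Finset.mul_sum]
  refine Finset.sum_le_sum fun j _ => ?_
  rw [Matrix.map_apply, ← sq_abs, ← sq_abs (A i j), ← mul_pow]
  exact pow_le_pow_left₀ (abs_nonneg _) (hσ _) 2

theorem specNorm_diagonal_le [DecidableEq n] {v : n → ℝ} {c : ℝ} (hc : 0 ≤ c)
    (hv : ∀ i, |v i| ≤ c) : specNorm (Matrix.diagonal v) ≤ c := by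
  rw [specNorm_eq_norm, Matrix.l2_opNorm_diagonal]
  exact (pi_norm_le_iff_of_nonneg hc).mpr hv

theorem specNorm_one_add_le [DecidableEq n] (A : Matrix n n ℝ) :
    specNorm (1 + A) ≤ 1 + specNorm A := by
  have h1 : specNorm (1 : Matrix n n ℝ) ≤ 1 := by
    rw [← Matrix.diagonal_one]
    exact specNorm_diagonal_le zero_le_one fun _ => by simp
  exact (norm_add_le (1 : Matrix n n ℝ) A).trans (add_le_add_left h1 _)

theorem specNorm_normAdj_le [DecidableEq n] (A : Matrix n n ℝ) {α : ℝ} (hα : 0 ≤ α)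
    (hdeg : ∀ i, α ≤ ∑ j, A i j) :
    specNorm (normAdj A) ≤ (1 + specNorm A) * (1 + α)⁻¹ := by
  have hpos : 0 < 1 + α := by linarith
  set c := (Real.sqrt (1 + α))⁻¹ with hc
  have hc0 : 0 ≤ c := by positivity
  have hD : specNorm (Matrix.diagonal fun i => (Real.sqrt (∑ j, (1 + A) i j))⁻¹) ≤ c := by
    refine specNorm_diagonal_le hc0 fun i => ?_
    rw [abs_of_nonneg (by positivity)]
    refine inv_anti₀ (Real.sqrt_pos.mpr hpos) (Real.sqrt_le_sqrt ?_)
    simp only [Matrix.add_apply, Finset.sum_add_distrib, Matrix.one_apply, Finset.sum_ite_eq,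
      Finset.mem_univ, if_true]
    linarith [hdeg i]
  have hcc : c * c = (1 + α)⁻¹ := by
    rw [hc, ← mul_inv, Real.mul_self_sqrt hpos.le]
  calc specNorm (normAdj A)
      ≤ specNorm (Matrix.diagonal fun i => (Real.sqrt (∑ j, (1 + A) i j))⁻¹) * specNorm (1 + A) *
          specNorm (Matrix.diagonal fun i => (Real.sqrt (∑ j, (1 + A) i j))⁻¹) :=
        (Matrix.l2_opNorm_mul _ _).trans
          (mul_le_mul_of_nonneg_right (Matrix.l2_opNorm_mul _ _) (specNorm_nonneg _))
    _ ≤ c * (1 + specNorm A) * c := by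
        have := specNorm_nonneg A
        have h1 := specNorm_nonneg (1 + A)
        refine mul_le_mul (mul_le_mul hD (specNorm_one_add_le A) h1 hc0) hD (specNorm_nonneg _) ?_
        positivity
    _ = (1 + specNorm A) * (1 + α)⁻¹ := by rw [← hcc]; ring

end L2Operator

theorem frobNorm_gcn_succ_le {v : Type*} [Fintype v] [DecidableEq v] (U : Matrix v v ℝ)
    {σ : ℝ → ℝ} {ρ : ℝ} (hρ : 0 ≤ ρ) (hσ : ∀ a, |σ a| ≤ ρ * |a|) {d : ℕ → ℕ}
    (W : (l : ℕ) → Matrix (Fin (d l)) (Fin (d (l + 1))) ℝ) (X : Matrix v (Fin (d 0)) ℝ) (l : ℕ) :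
    frobNorm (gcn U σ W X (l + 1)) ≤
      ρ * (specNorm U * frobNorm (gcn U σ W X l) * specNorm (W l)) :=
  (frobNorm_map_le _ hρ hσ).trans <| mul_le_mul_of_nonneg_left
    ((frobNorm_mul_le_mul_specNorm _ _).trans <| mul_le_mul_of_nonneg_right
      (frobNorm_mul_le_specNorm_mul _ _) (specNorm_nonneg _)) hρ

theorem frob_norm_gcn_embedding_le {n : ℕ} {d : ℕ → ℕ}
    (A : Matrix (Fin n) (Fin n) ℝ) (X : Matrix (Fin n) (Fin (d 0)) ℝ)
    (W : (l : ℕ) → Matrix (Fin (d l)) (Fin (d (l + 1))) ℝ) (L : ℕ)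
    (σ : ℝ → ℝ) (α βA βX βW ρ : ℝ)
    (hsymm : A.IsSymm) (hnonneg : ∀ i j, 0 ≤ A i j)
    (hα : 0 ≤ α) (hdeg : ∀ i, α ≤ ∑ j, A i j) (hA : specNorm A ≤ βA)
    (hX : frobNorm X ≤ βX) (hW : ∀ l < L, specNorm (W l) ≤ βW)
    (hρ : 0 ≤ ρ) (hσ : ∀ a b : ℝ, |σ a - σ b| ≤ ρ * |a - b|) (hσ0 : σ 0 = 0) :
    ∀ l, 1 ≤ l → l ≤ L →
      frobNorm (gcn (normAdj A) σ W X l) ≤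
        ρ ^ l * βW ^ l * βX * (1 + βA) ^ l * ((1 + α) ^ l)⁻¹ := by
  have hσ' : ∀ a, |σ a| ≤ ρ * |a| := fun a => by simpa [hσ0] using hσ a 0
  have hβX : 0 ≤ βX := (frobNorm_nonneg X).trans hX
  have hβA : 0 ≤ βA := (specNorm_nonneg A).trans hA
  have hU : specNorm (normAdj A) ≤ (1 + βA) * (1 + α)⁻¹ :=
    (specNorm_normAdj_le A hα hdeg).trans (by gcongr)
  rintro l - hl
  induction l with
  | zero => simpa [gcn] using hX
  | succ l ih =>
    have hβW : 0 ≤ βW := (specNorm_nonneg _).trans (hW l hl)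
    calc frobNorm (gcn (normAdj A) σ W X (l + 1))
        ≤ ρ * (specNorm (normAdj A) * frobNorm (gcn (normAdj A) σ W X l) * specNorm (W l)) :=
          frobNorm_gcn_succ_le _ hρ hσ' W X l
      _ ≤ ρ * ((1 + βA) * (1 + α)⁻¹ *
            (ρ ^ l * βW ^ l * βX * (1 + βA) ^ l * ((1 + α) ^ l)⁻¹) * βW) := by
          refine mul_le_mul_of_nonneg_left ?_ hρ
          exact mul_le_mul (mul_le_mul hU (ih (Nat.le_of_succ_le hl)) (frobNorm_nonneg _) (by positivity)) (hW l hl)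
            (specNorm_nonneg _) (by positivity)
      _ = _ := by
          rw [pow_succ (1 + α), mul_inv]
          ring
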